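/- arXiv:1107.2210 — 11 statements merged into one kernel-verified Lean document; each statement's English description precedes it below -/
import Mathlib

section
/- Let λ ∈ ℂ and let F_λ := 5·λ·s₂·s₃ + 6·s₅ ∈ ℂ[x₀,x₁,x₂,x₃], where for each k the symbol s_k denotes the power sum x₀^k + x₁^k + x₂^k + x₃^k + (−(x₀+x₁+x₂+x₃))^k. Then there exists a point x = (x₀,x₁,x₂,x₃) ∈ ℂ⁴, x ≠ 0, with F_λ(x) = 0 and all four partial derivatives ∂F_λ/∂x_i vanishing at x, if and only if λ ∈ {−1, −3/2, −51/50, −13/25, −1/2}. (That is, over ℂ the quintic surface S_λ is non-smooth exactly for these five values of λ.) -/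
open MvPolynomial

section QuarticRoots

variable {K : Type*} [Field K] {lam p q k a b c d e : K}

/-- A depressed quartic with three distinct roots `a, b, c` has fourth root `-(a + b + c)`:
this expresses its quadratic and linear coefficients. -/
theorem depressed_quartic_coeffs (ha : 6 * a ^ 4 + p * a ^ 2 + q * a = k)
    (hb : 6 * b ^ 4 + p * b ^ 2 + q * b = k) (hc : 6 * c ^ 4 + p * c ^ 2 + q * c = k)
    (hab : a ≠ b) (hac : a ≠ c) (hbc : b ≠ c) :
    p = -6 * (a ^ 2 + b ^ 2 + c ^ 2 + a * b + b * c + c * a) ∧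
      q = 6 * ((a + b) * (b + c) * (c + a)) := by
  have h1 : 6 * (a ^ 3 + a ^ 2 * b + a * b ^ 2 + b ^ 3) + p * (a + b) + q = 0 :=
    mul_left_cancel₀ (sub_ne_zero.2 hab) (by linear_combination ha - hb)
  have h2 : 6 * (a ^ 3 + a ^ 2 * c + a * c ^ 2 + c ^ 3) + p * (a + c) + q = 0 :=
    mul_left_cancel₀ (sub_ne_zero.2 hac) (by linear_combination ha - hc)
  have h3 : p = -6 * (a ^ 2 + b ^ 2 + c ^ 2 + a * b + b * c + c * a) :=
    mul_left_cancel₀ (sub_ne_zero.2 hbc) (by linear_combination h1 - h2)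
  exact ⟨h3, by linear_combination h1 - (a + b) * h3⟩

variable [CharZero K]

theorem depressed_quartic_sum_roots (ha : 6 * a ^ 4 + p * a ^ 2 + q * a = k)
    (hb : 6 * b ^ 4 + p * b ^ 2 + q * b = k) (hc : 6 * c ^ 4 + p * c ^ 2 + q * c = k)
    (hd : 6 * d ^ 4 + p * d ^ 2 + q * d = k) (hab : a ≠ b) (hac : a ≠ c) (had : a ≠ d)
    (hbc : b ≠ c) (hbd : b ≠ d) (hcd : c ≠ d) : a + b + c + d = 0 := by
  have h1 := (depressed_quartic_coeffs ha hb hc hab hac hbc).1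
  have h2 := (depressed_quartic_coeffs ha hb hd hab had hbd).1
  have h3 : (6 : K) * (c - d) ≠ 0 := mul_ne_zero (by norm_num) (sub_ne_zero.2 hcd)
  exact mul_left_cancel₀ h3 (by linear_combination h1 - h2)

theorem eq_of_quadruple (hs : 4 * a + b = 0) (h0 : a ≠ 0)
    (hp : p = 4 * a ^ 2 + b ^ 2) (hq : q = 4 * a ^ 3 + b ^ 3)
    (ha : 6 * a ^ 4 + 3 * lam * p * a ^ 2 + 2 * lam * q * a = k)
    (hb : 6 * b ^ 4 + 3 * lam * p * b ^ 2 + 2 * lam * q * b = k) : lam = -51 / 50 := by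
  subst hp hq
  obtain rfl : b = -4 * a := by linear_combination hs
  have h : (-1500 : K) * a ^ 4 ≠ 0 := mul_ne_zero (by norm_num) (pow_ne_zero _ h0)
  exact mul_left_cancel₀ h (by linear_combination ha - hb)

theorem eq_of_triple_double (hs : 3 * a + 2 * b = 0) (h0 : a ≠ 0)
    (hp : p = 3 * a ^ 2 + 2 * b ^ 2) (hq : q = 3 * a ^ 3 + 2 * b ^ 3)
    (ha : 6 * a ^ 4 + 3 * lam * p * a ^ 2 + 2 * lam * q * a = k)
    (hb : 6 * b ^ 4 + 3 * lam * p * b ^ 2 + 2 * lam * q * b = k) : lam = -13 / 25 := by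
  subst hp hq
  obtain rfl : b = -3 / 2 * a := by linear_combination hs / 2
  have h : (-375 / 8 : K) * a ^ 4 ≠ 0 := mul_ne_zero (by norm_num) (pow_ne_zero _ h0)
  exact mul_left_cancel₀ h (by linear_combination ha - hb)

theorem eq_of_triple (hs : 3 * a + b + c = 0) (hab : a ≠ b) (hac : a ≠ c) (hbc : b ≠ c)
    (hp : p = 3 * a ^ 2 + b ^ 2 + c ^ 2) (hq : q = 3 * a ^ 3 + b ^ 3 + c ^ 3)
    (ha : 6 * a ^ 4 + 3 * lam * p * a ^ 2 + 2 * lam * q * a = k)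
    (hb : 6 * b ^ 4 + 3 * lam * p * b ^ 2 + 2 * lam * q * b = k)
    (hc : 6 * c ^ 4 + 3 * lam * p * c ^ 2 + 2 * lam * q * c = k) : lam = -1 ∨ lam = -3 / 2 := by
  subst hp hq
  obtain ⟨h1, h2⟩ := depressed_quartic_coeffs ha hb hc hab hac hbc
  obtain rfl : c = -3 * a - b := by linear_combination hs
  by_cases h0 : a = 0
  · subst h0
    have h : (6 : K) * b ^ 2 ≠ 0 := mul_ne_zero (by norm_num) (pow_ne_zero _ hab.symm)
    exact .inl (mul_left_cancel₀ h (by linear_combination h1))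
  · right
    have h3 : b * (-3 * a - b) - 7 * a ^ 2 = lam * (6 * a ^ 2 - b * (-3 * a - b)) := by
      linear_combination -h1 / 6
    have h4 : 6 * a ^ 2 - 3 * (b * (-3 * a - b)) =
        lam * (3 * (b * (-3 * a - b)) - 8 * a ^ 2) := by
      refine mul_left_cancel₀ (mul_ne_zero (by norm_num : (6 : K) ≠ 0) h0) ?_
      linear_combination -h2
    have h5 : b * (-3 * a - b) = 4 * a ^ 2 := by
      have h : (-5 : K) * a ^ 2 ≠ 0 := mul_ne_zero (by norm_num) (pow_ne_zero _ h0)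
      refine mul_left_cancel₀ h ?_
      linear_combination (3 * (b * (-3 * a - b)) - 8 * a ^ 2) * h3 -
        (6 * a ^ 2 - b * (-3 * a - b)) * h4
    have h : (2 : K) * a ^ 2 ≠ 0 := mul_ne_zero (by norm_num) (pow_ne_zero _ h0)
    refine mul_left_cancel₀ h ?_
    linear_combination (1 + lam) * h5 - h3

theorem eq_of_double_double (hs : 2 * a + 2 * b + c = 0) (hab : a ≠ b) (hac : a ≠ c)
    (hbc : b ≠ c)
    (hp : p = 2 * a ^ 2 + 2 * b ^ 2 + c ^ 2) (hq : q = 2 * a ^ 3 + 2 * b ^ 3 + c ^ 3)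
    (ha : 6 * a ^ 4 + 3 * lam * p * a ^ 2 + 2 * lam * q * a = k)
    (hb : 6 * b ^ 4 + 3 * lam * p * b ^ 2 + 2 * lam * q * b = k)
    (hc : 6 * c ^ 4 + 3 * lam * p * c ^ 2 + 2 * lam * q * c = k) : lam = -1 ∨ lam = -1 / 2 := by
  subst hp hq
  obtain ⟨h1, h2⟩ := depressed_quartic_coeffs ha hb hc hab hac hbc
  obtain rfl : c = -2 * (a + b) := by linear_combination hs
  by_cases h0 : a + b = 0
  · right
    obtain rfl : b = -a := by linear_combination h0
    have hne : a ≠ 0 := by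
      rintro rfl
      simp at hab
    have h : (12 : K) * a ^ 2 ≠ 0 := mul_ne_zero (by norm_num) (pow_ne_zero _ hne)
    exact mul_left_cancel₀ h (by linear_combination h1)
  · left
    have h3 : a * b - 3 * (a + b) ^ 2 = lam * (3 * (a + b) ^ 2 - 2 * (a * b)) := by
      linear_combination -h1 / 6
    have h4 : a * b + 2 * (a + b) ^ 2 = -lam * (2 * (a + b) ^ 2 + 2 * (a * b)) := by
      refine mul_left_cancel₀ (mul_ne_zero (by norm_num : (6 : K) ≠ 0) h0) ?_
      linear_combination -h2
    have h5 : a * b = 0 := by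
      have h : (5 : K) * (a + b) ^ 2 ≠ 0 := mul_ne_zero (by norm_num) (pow_ne_zero _ h0)
      refine mul_left_cancel₀ h ?_
      linear_combination -(2 * (a + b) ^ 2 + 2 * (a * b)) * h3 -
        (3 * (a + b) ^ 2 - 2 * (a * b)) * h4
    have h : (3 : K) * (a + b) ^ 2 ≠ 0 := mul_ne_zero (by norm_num) (pow_ne_zero _ h0)
    refine mul_left_cancel₀ h ?_
    linear_combination (1 + 2 * lam) * h5 - h3

theorem eq_of_double (hs : 2 * a + b + c + d = 0) (hab : a ≠ b) (hac : a ≠ c) (had : a ≠ d)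
    (hbc : b ≠ c) (hbd : b ≠ d) (hcd : c ≠ d)
    (hp : p = 2 * a ^ 2 + b ^ 2 + c ^ 2 + d ^ 2) (hq : q = 2 * a ^ 3 + b ^ 3 + c ^ 3 + d ^ 3)
    (ha : 6 * a ^ 4 + 3 * lam * p * a ^ 2 + 2 * lam * q * a = k)
    (hb : 6 * b ^ 4 + 3 * lam * p * b ^ 2 + 2 * lam * q * b = k)
    (hc : 6 * c ^ 4 + 3 * lam * p * c ^ 2 + 2 * lam * q * c = k)
    (hd : 6 * d ^ 4 + 3 * lam * p * d ^ 2 + 2 * lam * q * d = k) : lam = -1 := by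
  subst hp hq
  have h1 := depressed_quartic_sum_roots ha hb hc hd hab hac had hbc hbd hcd
  obtain ⟨-, h2⟩ := depressed_quartic_coeffs ha hb hc hab hac hbc
  obtain rfl : a = 0 := by linear_combination hs - h1
  obtain rfl : d = -(b + c) := by linear_combination h1
  have h : (6 : K) * (b * c * -(b + c)) ≠ 0 :=
    mul_ne_zero (by norm_num) (mul_ne_zero (mul_ne_zero hab.symm hac.symm) had.symm)
  exact mul_left_cancel₀ h (by linear_combination h2)

/-- The values of `lam` for which the pencil has a singular member. -/
def IsSingularParameter (lam : K) : Prop :=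
  lam = -1 ∨ lam = -3 / 2 ∨ lam = -51 / 50 ∨ lam = -13 / 25 ∨ lam = -1 / 2

theorem isSingularParameter_of_quadruple (hs : 4 * a + b = 0) (h0 : ¬(a = 0 ∧ b = 0))
    (hp : p = 4 * a ^ 2 + b ^ 2) (hq : q = 4 * a ^ 3 + b ^ 3)
    (ha : 6 * a ^ 4 + 3 * lam * p * a ^ 2 + 2 * lam * q * a = k)
    (hb : 6 * b ^ 4 + 3 * lam * p * b ^ 2 + 2 * lam * q * b = k) : IsSingularParameter lam := by
  have hne : a ≠ 0 := by
    rintro rfl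
    exact h0 ⟨rfl, by linear_combination hs⟩
  have := eq_of_quadruple hs hne hp hq ha hb
  unfold IsSingularParameter
  tauto

theorem isSingularParameter_of_triple_double (hs : 3 * a + 2 * b = 0) (h0 : ¬(a = 0 ∧ b = 0))
    (hp : p = 3 * a ^ 2 + 2 * b ^ 2) (hq : q = 3 * a ^ 3 + 2 * b ^ 3)
    (ha : 6 * a ^ 4 + 3 * lam * p * a ^ 2 + 2 * lam * q * a = k)
    (hb : 6 * b ^ 4 + 3 * lam * p * b ^ 2 + 2 * lam * q * b = k) : IsSingularParameter lam := by
  have hne : a ≠ 0 := by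
    rintro rfl
    exact h0 ⟨rfl, by linear_combination hs / 2⟩
  have := eq_of_triple_double hs hne hp hq ha hb
  unfold IsSingularParameter
  tauto

theorem isSingularParameter_of_triple (hs : 3 * a + b + c = 0) (h0 : ¬(a = 0 ∧ b = 0 ∧ c = 0))
    (hp : p = 3 * a ^ 2 + b ^ 2 + c ^ 2) (hq : q = 3 * a ^ 3 + b ^ 3 + c ^ 3)
    (ha : 6 * a ^ 4 + 3 * lam * p * a ^ 2 + 2 * lam * q * a = k)
    (hb : 6 * b ^ 4 + 3 * lam * p * b ^ 2 + 2 * lam * q * b = k)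
    (hc : 6 * c ^ 4 + 3 * lam * p * c ^ 2 + 2 * lam * q * c = k) : IsSingularParameter lam := by
  rcases eq_or_ne a b with rfl | hab
  · exact isSingularParameter_of_quadruple (by linear_combination hs) (by tauto)
      (by linear_combination hp) (by linear_combination hq) ha hc
  rcases eq_or_ne a c with rfl | hac
  · exact isSingularParameter_of_quadruple (by linear_combination hs) (by tauto)
      (by linear_combination hp) (by linear_combination hq) ha hb
  rcases eq_or_ne b c with rfl | hbc
  · exact isSingularParameter_of_triple_double (by linear_combination hs) (by tauto)
      (by linear_combination hp) (by linear_combination hq) ha hb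
  have := eq_of_triple hs hab hac hbc hp hq ha hb hc
  unfold IsSingularParameter
  tauto

theorem isSingularParameter_of_double_double (hs : 2 * a + 2 * b + c = 0)
    (h0 : ¬(a = 0 ∧ b = 0 ∧ c = 0))
    (hp : p = 2 * a ^ 2 + 2 * b ^ 2 + c ^ 2) (hq : q = 2 * a ^ 3 + 2 * b ^ 3 + c ^ 3)
    (ha : 6 * a ^ 4 + 3 * lam * p * a ^ 2 + 2 * lam * q * a = k)
    (hb : 6 * b ^ 4 + 3 * lam * p * b ^ 2 + 2 * lam * q * b = k)
    (hc : 6 * c ^ 4 + 3 * lam * p * c ^ 2 + 2 * lam * q * c = k) : IsSingularParameter lam := by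
  rcases eq_or_ne a b with rfl | hab
  · exact isSingularParameter_of_quadruple (by linear_combination hs) (by tauto)
      (by linear_combination hp) (by linear_combination hq) ha hc
  rcases eq_or_ne a c with rfl | hac
  · exact isSingularParameter_of_triple_double (by linear_combination hs) (by tauto)
      (by linear_combination hp) (by linear_combination hq) ha hb
  rcases eq_or_ne b c with rfl | hbc
  · exact isSingularParameter_of_triple_double (by linear_combination hs) (by tauto)
      (by linear_combination hp) (by linear_combination hq) hb ha
  have := eq_of_double_double hs hab hac hbc hp hq ha hb hc
  unfold IsSingularParameter
  tauto

theorem isSingularParameter_of_double (hs : 2 * a + b + c + d = 0)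
    (h0 : ¬(a = 0 ∧ b = 0 ∧ c = 0 ∧ d = 0))
    (hp : p = 2 * a ^ 2 + b ^ 2 + c ^ 2 + d ^ 2) (hq : q = 2 * a ^ 3 + b ^ 3 + c ^ 3 + d ^ 3)
    (ha : 6 * a ^ 4 + 3 * lam * p * a ^ 2 + 2 * lam * q * a = k)
    (hb : 6 * b ^ 4 + 3 * lam * p * b ^ 2 + 2 * lam * q * b = k)
    (hc : 6 * c ^ 4 + 3 * lam * p * c ^ 2 + 2 * lam * q * c = k)
    (hd : 6 * d ^ 4 + 3 * lam * p * d ^ 2 + 2 * lam * q * d = k) :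
    IsSingularParameter lam := by
  rcases eq_or_ne a b with rfl | hab
  · exact isSingularParameter_of_triple (by linear_combination hs) (by tauto)
      (by linear_combination hp) (by linear_combination hq) ha hc hd
  rcases eq_or_ne a c with rfl | hac
  · exact isSingularParameter_of_triple (by linear_combination hs) (by tauto)
      (by linear_combination hp) (by linear_combination hq) ha hb hd
  rcases eq_or_ne a d with rfl | had
  · exact isSingularParameter_of_triple (by linear_combination hs) (by tauto)
      (by linear_combination hp) (by linear_combination hq) ha hb hc
  rcases eq_or_ne b c with rfl | hbc
  · exact isSingularParameter_of_double_double (by linear_combination hs) (by tauto)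
      (by linear_combination hp) (by linear_combination hq) ha hb hd
  rcases eq_or_ne b d with rfl | hbd
  · exact isSingularParameter_of_double_double (by linear_combination hs) (by tauto)
      (by linear_combination hp) (by linear_combination hq) ha hb hc
  rcases eq_or_ne c d with rfl | hcd
  · exact isSingularParameter_of_double_double (by linear_combination hs) (by tauto)
      (by linear_combination hp) (by linear_combination hq) ha hc hb
  exact .inl (eq_of_double hs hab hac had hbc hbd hcd hp hq ha hb hc hd)

theorem isSingularParameter_of_quartic_values_eq (hs : a + b + c + d + e = 0)
    (h0 : ¬(a = 0 ∧ b = 0 ∧ c = 0 ∧ d = 0 ∧ e = 0))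
    (hp : p = a ^ 2 + b ^ 2 + c ^ 2 + d ^ 2 + e ^ 2)
    (hq : q = a ^ 3 + b ^ 3 + c ^ 3 + d ^ 3 + e ^ 3)
    (ha : 6 * a ^ 4 + 3 * lam * p * a ^ 2 + 2 * lam * q * a = k)
    (hb : 6 * b ^ 4 + 3 * lam * p * b ^ 2 + 2 * lam * q * b = k)
    (hc : 6 * c ^ 4 + 3 * lam * p * c ^ 2 + 2 * lam * q * c = k)
    (hd : 6 * d ^ 4 + 3 * lam * p * d ^ 2 + 2 * lam * q * d = k)
    (he : 6 * e ^ 4 + 3 * lam * p * e ^ 2 + 2 * lam * q * e = k) :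
    IsSingularParameter lam := by
  rcases eq_or_ne a b with rfl | hab
  · exact isSingularParameter_of_double (by linear_combination hs) (by tauto)
      (by linear_combination hp) (by linear_combination hq) ha hc hd he
  rcases eq_or_ne a c with rfl | hac
  · exact isSingularParameter_of_double (by linear_combination hs) (by tauto)
      (by linear_combination hp) (by linear_combination hq) ha hb hd he
  rcases eq_or_ne a d with rfl | had
  · exact isSingularParameter_of_double (by linear_combination hs) (by tauto)
      (by linear_combination hp) (by linear_combination hq) ha hb hc he
  rcases eq_or_ne a e with rfl | hae
  · exact isSingularParameter_of_double (by linear_combination hs) (by tauto)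
      (by linear_combination hp) (by linear_combination hq) ha hb hc hd
  rcases eq_or_ne b c with rfl | hbc
  · exact isSingularParameter_of_double (by linear_combination hs) (by tauto)
      (by linear_combination hp) (by linear_combination hq) hb ha hd he
  rcases eq_or_ne b d with rfl | hbd
  · exact isSingularParameter_of_double (by linear_combination hs) (by tauto)
      (by linear_combination hp) (by linear_combination hq) hb ha hc he
  rcases eq_or_ne b e with rfl | hbe
  · exact isSingularParameter_of_double (by linear_combination hs) (by tauto)
      (by linear_combination hp) (by linear_combination hq) hb ha hc hd
  rcases eq_or_ne c d with rfl | hcd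
  · exact isSingularParameter_of_double (by linear_combination hs) (by tauto)
      (by linear_combination hp) (by linear_combination hq) hc ha hb he
  rcases eq_or_ne c e with rfl | hce
  · exact isSingularParameter_of_double (by linear_combination hs) (by tauto)
      (by linear_combination hp) (by linear_combination hq) hc ha hb hd
  rcases eq_or_ne d e with rfl | hde
  · exact isSingularParameter_of_double (by linear_combination hs) (by tauto)
      (by linear_combination hp) (by linear_combination hq) hd ha hb hc
  have h1 := depressed_quartic_sum_roots ha hb hc hd hab hac had hbc hbd hcd
  have h2 := depressed_quartic_sum_roots ha hb hc he hab hac hae hbc hbe hce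
  exact absurd (by linear_combination h1 - h2) hde

end QuarticRoots

/-- The function whose values at the five coordinates agree exactly at the singular points. -/
def criticalQuartic (lam : ℂ) (x : Fin 4 → ℂ) (t : ℂ) : ℂ :=
  6 * t ^ 4 +
    3 * lam * (x 0 ^ 2 + x 1 ^ 2 + x 2 ^ 2 + x 3 ^ 2 + (-(x 0 + x 1 + x 2 + x 3)) ^ 2) * t ^ 2 +
    2 * lam * (x 0 ^ 3 + x 1 ^ 3 + x 2 ^ 3 + x 3 ^ 3 + (-(x 0 + x 1 + x 2 + x 3)) ^ 3) * t

theorem singular_iff_criticalQuartic (lam : ℂ) (s : ℕ → MvPolynomial (Fin 4) ℂ)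
    (hs : ∀ k, s k =
      X 0 ^ k + X 1 ^ k + X 2 ^ k + X 3 ^ k + (-(X 0 + X 1 + X 2 + X 3)) ^ k)
    (F : MvPolynomial (Fin 4) ℂ) (hF : F = 5 * C lam * s 2 * s 3 + 6 * s 5)
    (x : Fin 4 → ℂ) :
    (eval x F = 0 ∧ ∀ i : Fin 4, eval x (pderiv i F) = 0) ↔
      ∀ i, criticalQuartic lam x (x i) = criticalQuartic lam x (-(x 0 + x 1 + x 2 + x 3)) := by
  have hd : ∀ i, eval x (pderiv i F) =
      5 * (criticalQuartic lam x (x i) -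
        criticalQuartic lam x (-(x 0 + x 1 + x 2 + x 3))) := by
    intro i
    have h (k : ℕ) : eval x (pderiv i (s (k + 1))) =
        (k + 1) * (x i ^ k - (-(x 0 + x 1 + x 2 + x 3)) ^ k) := by
      fin_cases i <;>
      · simp [hs, Derivation.leibniz_pow, pderiv_X]
        ring
    have h5 : pderiv i (5 * C lam : MvPolynomial (Fin 4) ℂ) = 0 := by
      rw [show (5 * C lam : MvPolynomial (Fin 4) ℂ) = C (5 * lam) from (C_mul (a := 5)).symm,
        pderiv_C]
    have h6 : pderiv i (6 : MvPolynomial (Fin 4) ℂ) = 0 := pderiv_C (a := (6 : ℂ))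
    simp only [hF, map_add, Derivation.leibniz, h5, h6, smul_eq_mul, map_mul, h, map_zero]
    simp [hs, criticalQuartic]
    ring
  have he : 5 * eval x F = ∑ i, x i * eval x (pderiv i F) := by
    simp only [hd, Fin.sum_univ_four]
    simp [hF, hs, criticalQuartic]
    ring
  constructor
  · rintro ⟨-, h⟩ i
    simpa [hd, sub_eq_zero] using h i
  · intro h
    have h' : ∀ i, eval x (pderiv i F) = 0 := fun i => by simp [hd, h i]
    exact ⟨by simpa [h'] using he, h'⟩

/-- Over ℂ, the quintic `S_λ` (realised as `{F_λ = 0} ⊂ ℙ³` with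
`F_λ = 5·λ·s₂·s₃ + 6·s₅`) is non-smooth exactly for
`λ ∈ {−1, −3/2, −51/50, −13/25, −1/2}`. -/
theorem barth_pencil_singular_parameters (lam : ℂ)
    (s : ℕ → MvPolynomial (Fin 4) ℂ)
    (hs : ∀ k, s k =
      X 0 ^ k + X 1 ^ k + X 2 ^ k + X 3 ^ k + (-(X 0 + X 1 + X 2 + X 3)) ^ k)
    (F : MvPolynomial (Fin 4) ℂ)
    (hF : F = 5 * C lam * s 2 * s 3 + 6 * s 5) :
    (∃ x : Fin 4 → ℂ, x ≠ 0 ∧ eval x F = 0 ∧ ∀ i : Fin 4, eval x (pderiv i F) = 0) ↔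
      lam ∈ ({-1, -3/2, -51/50, -13/25, -1/2} : Set ℂ) := by
  simp only [singular_iff_criticalQuartic lam s hs F hF]
  constructor
  · rintro ⟨x, hx, h⟩
    simp only [criticalQuartic] at h
    have h0 : ¬(x 0 = 0 ∧ x 1 = 0 ∧ x 2 = 0 ∧ x 3 = 0 ∧ -(x 0 + x 1 + x 2 + x 3) = 0) := by
      rintro ⟨h0, h1, h2, h3, -⟩
      refine hx (funext fun i => ?_)
      fin_cases i <;> assumption
    exact isSingularParameter_of_quartic_values_eq (by ring) h0 rfl rfl (h 0) (h 1) (h 2) (h 3) rfl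
  · rintro (rfl | rfl | rfl | rfl | rfl)
    · refine ⟨![1, -1, 0, 0], fun h => by simpa using congrFun h 0, fun i => ?_⟩
      fin_cases i <;> simp [criticalQuartic] <;> norm_num
    · obtain ⟨r, hr⟩ := IsAlgClosed.exists_pow_nat_eq (-7 : ℂ) two_pos
      refine ⟨![1, 1, 1, (-3 + r) / 2], fun h => by simpa using congrFun h 0, fun i => ?_⟩
      have hr3 : r ^ 3 = -7 * r := by linear_combination r * hr
      have hr4 : r ^ 4 = 49 := by linear_combination (r ^ 2 - 7) * hr
      fin_cases i <;> simp [criticalQuartic] <;> ring_nf <;> simp [hr, hr3, hr4] <;> ring_nf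
    · refine ⟨![1, 1, 1, 1], fun h => by simpa using congrFun h 0, fun i => ?_⟩
      fin_cases i <;> simp [criticalQuartic] <;> norm_num
    · refine ⟨![2, 2, 2, -3], fun h => by simpa using congrFun h 0, fun i => ?_⟩
      fin_cases i <;> simp [criticalQuartic] <;> norm_num
    · refine ⟨![1, 1, -1, -1], fun h => by simpa using congrFun h 0, fun i => ?_⟩
      fin_cases i <;> simp [criticalQuartic] <;> norm_num
end

section
/- Let b ∈ ℂ satisfy b⁴ − b³ + 1 = 0. Then b + 2 ≠ 0, and setting a := −2/(b+2), the polynomial F_a := 5·a·s₂·s₃ + 6·s₅ ∈ ℂ[x₀,x₁,x₂,x₃] (where s_k := x₀^k + x₁^k + x₂^k + x₃^k + (−(x₀+x₁+x₂+x₃))^k) has no singular point: for every x ∈ ℂ⁴ with x ≠ 0, at least one of the four partial derivatives ∂F_a/∂x_i does not vanish at x. (That is, the Barth quintic S_a is smooth over ℂ.) -/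
open MvPolynomial

/-- The roots of a depressed quartic, listed with multiplicity, have the power sums prescribed by
Newton's identities. -/
theorem exists_roots_depressed_quartic {K : Type*} [Field K] [IsAlgClosed K] [CharZero K]
    (A B c : K) :
    ∃ r : Fin 4 → K, ∑ j, r j = 0 ∧ ∑ j, r j ^ 2 = -2 * A ∧ ∑ j, r j ^ 3 = -3 * B ∧
      ∀ t, t ^ 4 + A * t ^ 2 + B * t = c → ∃ j, t = r j := by
  let P : Polynomial K := .X ^ 4 + .C A * .X ^ 2 + .C B * .X + .C (-c)
  have hdeg : P.natDegree = 4 := by unfold P; compute_degree!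
  have hmonic : P.Monic := by unfold P; monicity!
  have hsplit : P.Splits := IsAlgClosed.splits P
  have hcard : P.roots.toList.length = 4 := by
    rw [Multiset.length_toList, ← hsplit.natDegree_eq_card_roots, hdeg]
  obtain ⟨r₀, r₁, r₂, r₃, hr⟩ : ∃ r₀ r₁ r₂ r₃, P.roots.toList = [r₀, r₁, r₂, r₃] := by
    match P.roots.toList, hcard with
    | [r₀, r₁, r₂, r₃], _ => exact ⟨r₀, r₁, r₂, r₃, rfl⟩
  have hroots : P.roots = ([r₀, r₁, r₂, r₃] : List K) := by rw [← hr, Multiset.coe_toList]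
  have hprod := hsplit.eq_prod_roots_of_monic hmonic
  rw [hroots] at hprod
  have heval (t : K) : t ^ 4 + A * t ^ 2 + B * t - c =
      (t - r₀) * (t - r₁) * (t - r₂) * (t - r₃) := by
    have := congrArg (Polynomial.eval t) hprod
    simp [P] at this
    linear_combination this
  have h₀ := heval 0
  have h₁ := heval 1
  have h₂ := heval (-1)
  have h₃ := heval 2
  have e₁ : r₀ + r₁ + r₂ + r₃ = 0 := by
    linear_combination (1 / 6 : K) * h₃ - (1 / 2 : K) * h₁ - (1 / 6 : K) * h₂ + (1 / 2 : K) * h₀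
  have e₂ : r₀ * r₁ + r₀ * r₂ + r₀ * r₃ + r₁ * r₂ + r₁ * r₃ + r₂ * r₃ = A := by
    linear_combination h₀ - (1 / 2 : K) * h₁ - (1 / 2 : K) * h₂
  have e₃ : r₀ * r₁ * r₂ + r₀ * r₁ * r₃ + r₀ * r₂ * r₃ + r₁ * r₂ * r₃ = -B := by
    linear_combination (1 / 2 : K) * h₁ - (1 / 2 : K) * h₂ - e₁
  refine ⟨![r₀, r₁, r₂, r₃], ?_, ?_, ?_, fun t ht ↦ ?_⟩
  · simpa [Fin.sum_univ_four] using e₁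
  · simp only [Fin.sum_univ_four, Matrix.cons_val]
    linear_combination (r₀ + r₁ + r₂ + r₃) * e₁ - 2 * e₂
  · simp only [Fin.sum_univ_four, Matrix.cons_val]
    linear_combination ((r₀ + r₁ + r₂ + r₃) ^ 2 - 3 * (r₀ * r₁ + r₀ * r₂ + r₀ * r₃ + r₁ * r₂ +
      r₁ * r₃ + r₂ * r₃)) * e₁ + 3 * e₃
  · have := heval t
    rw [ht, sub_self, eq_comm, mul_eq_zero, mul_eq_zero, mul_eq_zero] at this
    simp only [sub_eq_zero] at this
    rcases this with ((h | h) | h) | h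
    exacts [⟨0, h⟩, ⟨1, h⟩, ⟨2, h⟩, ⟨3, h⟩]

theorem eq_zero_of_add_of_mul {K : Type*} [Field K] {u v : K} (hadd : u + v = 0)
    (hmul : u * v = 0) : u = 0 ∧ v = 0 := by
  rcases mul_eq_zero.1 hmul with rfl | rfl <;> simp_all

theorem eq_zero_of_power_sums_three {K : Type*} [Field K] [CharZero K] {u v w : K}
    (h₁ : u + v + w = 0) (h₂ : u ^ 2 + v ^ 2 + w ^ 2 = 0) (h₃ : u ^ 3 + v ^ 3 + w ^ 3 = 0) :
    u = 0 ∧ v = 0 ∧ w = 0 := by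
  have e₂ : u * v + u * w + v * w = 0 := by
    linear_combination (1 / 2 : K) * (u + v + w) * h₁ - (1 / 2 : K) * h₂
  have e₃ : u * v * w = 0 := by
    linear_combination (1 / 3 : K) * h₃ - (1 / 3 : K) * (u + v + w) ^ 2 * h₁ +
      (u + v + w) * e₂
  have hcube (t : K) (ht : (t - u) * (t - v) * (t - w) = 0) : t = 0 := by
    refine pow_eq_zero_iff (n := 3) (by norm_num) |>.1 ?_
    linear_combination ht + t ^ 2 * h₁ - t * e₂ + e₃
  exact ⟨hcube u (by ring), hcube v (by ring), hcube w (by ring)⟩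

/-- Outside of five exceptional values of `l`, the equations satisfied by the roots `r j` of the
quartic attached to a singular point, with multiplicities `n j`, have only the trivial solution. -/
theorem eq_zero_of_weighted_power_sums {K : Type*} [Field K] [CharZero K] {l : K}
    (hl₁ : 1 + l ≠ 0) (hl₂ : 1 + 2 * l ≠ 0) (hl₃ : 3 + 2 * l ≠ 0) (hl₄ : 13 + 25 * l ≠ 0)
    (hl₅ : 51 + 50 * l ≠ 0) (n : Fin 4 → ℕ) (r : Fin 4 → K) (hn : ∑ j, n j = 5)
    (hr : ∑ j, r j = 0) (h₁ : ∑ j, n j * r j = 0) (h₂ : ∑ j, (1 + l * n j) * r j ^ 2 = 0)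
    (h₃ : ∑ j, (1 + l * n j) * r j ^ 3 = 0) : r = 0 := by
  wlog hmono : Monotone n generalizing n r
  · have hsort := this (n ∘ Tuple.sort n) (r ∘ Tuple.sort n)
      (by simpa only [Function.comp_apply, Equiv.sum_comp (Tuple.sort n) n] using hn)
      (by simpa only [Function.comp_apply, Equiv.sum_comp (Tuple.sort n) r] using hr)
      (by simpa only [Function.comp_apply, Equiv.sum_comp (Tuple.sort n) fun j ↦ n j * r j]
        using h₁)
      (by simpa only [Function.comp_apply,
        Equiv.sum_comp (Tuple.sort n) fun j ↦ (1 + l * n j) * r j ^ 2] using h₂)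
      (by simpa only [Function.comp_apply,
        Equiv.sum_comp (Tuple.sort n) fun j ↦ (1 + l * n j) * r j ^ 3] using h₃)
      (Tuple.monotone_sort n)
    ext j
    simpa using congrFun hsort ((Tuple.sort n).symm j)
  have m₀ : n 0 ≤ n 1 := hmono (by decide)
  have m₁ : n 1 ≤ n 2 := hmono (by decide)
  have m₂ : n 2 ≤ n 3 := hmono (by decide)
  simp only [Fin.sum_univ_four] at hn hr h₁ h₂ h₃
  suffices r 0 = 0 ∧ r 1 = 0 ∧ r 2 = 0 ∧ r 3 = 0 by
    ext j
    fin_cases j <;> simp [this]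
  generalize r 0 = r₀, r 1 = r₁, r 2 = r₂, r 3 = r₃ at *
  have hcases : n 0 = 1 ∧ n 1 = 1 ∧ n 2 = 1 ∧ n 3 = 2 ∨ n 0 = 0 ∧ n 1 = 1 ∧ n 2 = 2 ∧ n 3 = 2 ∨
      n 0 = 0 ∧ n 1 = 1 ∧ n 2 = 1 ∧ n 3 = 3 ∨ n 0 = 0 ∧ n 1 = 0 ∧ n 2 = 2 ∧ n 3 = 3 ∨
      n 0 = 0 ∧ n 1 = 0 ∧ n 2 = 1 ∧ n 3 = 4 ∨ n 0 = 0 ∧ n 1 = 0 ∧ n 2 = 0 ∧ n 3 = 5 := by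
    omega
  rcases hcases with ⟨q₀, q₁, q₂, q₃⟩ | ⟨q₀, q₁, q₂, q₃⟩ | ⟨q₀, q₁, q₂, q₃⟩ | ⟨q₀, q₁, q₂, q₃⟩ |
    ⟨q₀, q₁, q₂, q₃⟩ | ⟨q₀, q₁, q₂, q₃⟩ <;>
    rw [q₀, q₁, q₂, q₃] at h₁ h₂ h₃ <;> push_cast at h₁ h₂ h₃
  · obtain rfl : r₃ = 0 := by linear_combination h₁ - hr
    have := eq_zero_of_power_sums_three (u := r₀) (v := r₁) (w := r₂) (by linear_combination hr)
      (mul_left_cancel₀ hl₁ (by linear_combination h₂))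
      (mul_left_cancel₀ hl₁ (by linear_combination h₃))
    simpa using this
  · obtain rfl : r₁ = -2 * (r₂ + r₃) := by linear_combination h₁
    obtain rfl : r₀ = r₂ + r₃ := by linear_combination hr
    have hp : r₂ + r₃ = 0 := by
      have : (1 + l) * (r₂ + r₃) ^ 3 = 0 := by
        linear_combination (-1 / 15 : K) * h₃ + (1 / 10 : K) * (r₂ + r₃) * h₂
      simpa [hl₁] using this
    have hq : r₂ * r₃ = 0 := mul_left_cancel₀ hl₂ (by
      linear_combination 3 * (1 + l) * (r₂ + r₃) * hp - (1 / 2 : K) * h₂)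
    simp [eq_zero_of_add_of_mul hp hq]
  · obtain rfl : r₀ = 2 * r₃ := by linear_combination hr - h₁
    obtain rfl : r₁ = -3 * r₃ - r₂ := by linear_combination h₁
    obtain rfl : r₃ = 0 := by
      have : (3 + 2 * l) * r₃ ^ 3 = 0 := by
        linear_combination (1 / 15 : K) * h₃ + (3 / 10 : K) * r₃ * h₂
      simpa [hl₃] using this
    have : (1 + l) * r₂ ^ 2 = 0 := by linear_combination (1 / 2 : K) * h₂
    simpa [hl₁] using this
  · obtain ⟨w, rfl, rfl⟩ : ∃ w, r₂ = 3 * w ∧ r₃ = -2 * w :=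
      ⟨r₂ + r₃, by linear_combination -h₁, by linear_combination h₁⟩
    obtain rfl : r₀ = -w - r₁ := by linear_combination hr
    obtain rfl : w = 0 := by
      have : (13 + 25 * l) * w ^ 3 = 0 := by
        linear_combination (1 / 3 : K) * h₃ + (1 / 2 : K) * w * h₂
      simpa [hl₄] using this
    have : r₁ ^ 2 = 0 := by linear_combination (1 / 2 : K) * h₂
    simpa using this
  · obtain rfl : r₂ = -4 * r₃ := by linear_combination h₁
    obtain rfl : r₀ = 3 * r₃ - r₁ := by linear_combination hr
    obtain rfl : r₃ = 0 := by
      have : (51 + 50 * l) * r₃ ^ 3 = 0 := by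
        linear_combination (-1 / 3 : K) * h₃ + (3 / 2 : K) * r₃ * h₂
      simpa [hl₅] using this
    have : r₁ ^ 2 = 0 := by linear_combination (1 / 2 : K) * h₂
    simpa using this
  · obtain rfl : r₃ = 0 := by linear_combination (1 / 5 : K) * h₁
    have := eq_zero_of_power_sums_three (u := r₀) (v := r₁) (w := r₂) (by linear_combination hr)
      (by linear_combination h₂) (by linear_combination h₃)
    simpa using this

/-- Outside of five exceptional parameters `l`, five numbers with vanishing sum on which
`6t⁴ + 3l·s₂·t² + 2l·s₃·t` is constant are all zero. -/
theorem eq_zero_of_gradient_const {K : Type*} [Field K] [IsAlgClosed K] [CharZero K] {l : K}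
    (hl₁ : 1 + l ≠ 0) (hl₂ : 1 + 2 * l ≠ 0) (hl₃ : 3 + 2 * l ≠ 0) (hl₄ : 13 + 25 * l ≠ 0)
    (hl₅ : 51 + 50 * l ≠ 0) (y : Fin 5 → K) (c : K) (hy : ∑ i, y i = 0)
    (hc : ∀ i, 6 * y i ^ 4 + 3 * l * (∑ k, y k ^ 2) * y i ^ 2 + 2 * l * (∑ k, y k ^ 3) * y i = c) :
    y = 0 := by
  obtain ⟨r, hr₁, hr₂, hr₃, hroot⟩ := exists_roots_depressed_quartic
    (l * (∑ k, y k ^ 2) / 2) (l * (∑ k, y k ^ 3) / 3) (c / 6)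
  choose f hf using fun i ↦ hroot (y i) (by linear_combination (1 / 6 : K) * hc i)
  let n : Fin 4 → ℕ := fun j ↦ (Finset.univ.filter fun i ↦ f i = j).card
  have hsum (g : K → K) : ∑ i, g (y i) = ∑ j, n j * g (r j) := by
    simp only [hf, n]
    rw [← Finset.sum_fiberwise _ f]
    refine Finset.sum_congr rfl fun j _ ↦ ?_
    rw [Finset.sum_congr rfl fun i hi ↦ by rw [(Finset.mem_filter.1 hi).2], Finset.sum_const,
      nsmul_eq_mul]
  have hn : ∑ j, n j = 5 := by
    simpa [n] using (Finset.card_eq_sum_card_fiberwise (f := f) (s := Finset.univ)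
      (t := Finset.univ) (fun _ _ ↦ Finset.mem_coe.2 (Finset.mem_univ _))).symm
  have hweight (m : ℕ) (hm : ∑ j, r j ^ m = -l * ∑ k, y k ^ m) :
      ∑ j, (1 + l * n j) * r j ^ m = 0 := by
    simp only [add_mul, one_mul, Finset.sum_add_distrib, mul_assoc, ← Finset.mul_sum]
    rw [← hsum fun t ↦ t ^ m, hm]
    ring
  have hr := eq_zero_of_weighted_power_sums hl₁ hl₂ hl₃ hl₄ hl₅ n r hn hr₁
    (by rw [← hsum fun t ↦ t, hy]) (hweight 2 (by rw [hr₂]; ring)) (hweight 3 (by rw [hr₃]; ring))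
  ext i
  simp [hf, hr]

/-- The Barth quintic `S_a` with `a = −2/(b+2)`, `b⁴ − b³ + 1 = 0`, is smooth over ℂ:
`b + 2 ≠ 0`, and the quintic `F_a = 5·a·s₂·s₃ + 6·s₅ ⊂ ℙ³` has no singular point. -/
theorem barth_quintic_smooth (b : ℂ) (hb : b ^ 4 - b ^ 3 + 1 = 0) :
    b + 2 ≠ 0 ∧
    ∀ s : ℕ → MvPolynomial (Fin 4) ℂ,
      (∀ k, s k =
        X 0 ^ k + X 1 ^ k + X 2 ^ k + X 3 ^ k + (-(X 0 + X 1 + X 2 + X 3)) ^ k) →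
      ∀ F : MvPolynomial (Fin 4) ℂ,
        F = 5 * C (-2 / (b + 2)) * s 2 * s 3 + 6 * s 5 →
        ∀ x : Fin 4 → ℂ, x ≠ 0 → ∃ i : Fin 4, eval x (pderiv i F) ≠ 0 := by
  have hb_ne (q : ℂ) (hq : q ^ 4 - q ^ 3 + 1 ≠ 0) : b ≠ q := by
    rintro rfl
    exact hq hb
  have hb₂ : b + 2 ≠ 0 := fun h ↦
    hb_ne (-2) (by norm_num) (by linear_combination h)
  refine ⟨hb₂, fun s hs F hF x hx ↦ ?_⟩
  generalize hl : -2 / (b + 2) = l at hF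
  have hlb : l * (b + 2) = -2 := by rw [← hl]; field_simp
  by_contra! hsing
  let S : ℂ := x 0 + x 1 + x 2 + x 3
  have hy := eq_zero_of_gradient_const (l := l)
    (fun h ↦ hb_ne 0 (by norm_num) (by linear_combination (b + 2) * h - hlb))
    (fun h ↦ hb_ne 2 (by norm_num) (by linear_combination (b + 2) * h - 2 * hlb))
    (fun h ↦ hb_ne (-2 / 3) (by norm_num)
      (by linear_combination (1 / 3 : ℂ) * ((b + 2) * h - 2 * hlb)))
    (fun h ↦ hb_ne (24 / 13) (by norm_num)
      (by linear_combination (1 / 13 : ℂ) * ((b + 2) * h - 25 * hlb)))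
    (fun h ↦ hb_ne (-2 / 51) (by norm_num)
      (by linear_combination (1 / 51 : ℂ) * ((b + 2) * h - 50 * hlb)))
    ![x 0, x 1, x 2, x 3, -S]
    (6 * S ^ 4 + 3 * l * (x 0 ^ 2 + x 1 ^ 2 + x 2 ^ 2 + x 3 ^ 2 + S ^ 2) * S ^ 2
      - 2 * l * (x 0 ^ 3 + x 1 ^ 3 + x 2 ^ 3 + x 3 ^ 3 - S ^ 3) * S)
    (by simp [Fin.sum_univ_five, S]) (by
      simp only [hF, hs] at hsing
      have h₅ (i : Fin 4) : pderiv i (5 : MvPolynomial (Fin 4) ℂ) = 0 :=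
        (pderiv i).map_natCast 5
      have h₆ (i : Fin 4) : pderiv i (6 : MvPolynomial (Fin 4) ℂ) = 0 :=
        (pderiv i).map_natCast 6
      have d₀ := hsing 0
      have d₁ := hsing 1
      have d₂ := hsing 2
      have d₃ := hsing 3
      simp [pderiv_X, h₅, h₆, Derivation.leibniz, Derivation.leibniz_pow]
        at d₀ d₁ d₂ d₃
      intro i
      fin_cases i <;> simp [Fin.sum_univ_five, S]
      · linear_combination (1 / 5 : ℂ) * d₀
      · linear_combination (1 / 5 : ℂ) * d₁
      · linear_combination (1 / 5 : ℂ) * d₂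
      · linear_combination (1 / 5 : ℂ) * d₃
      · ring)
  refine hx (funext fun i ↦ ?_)
  have := congrFun hy i.castSucc
  fin_cases i <;> simpa using this
end

section
/- Let K be a field whose characteristic is not one of 3, 5, 11, 17, 433, and let b ∈ K satisfy b⁴ − b³ + 1 = 0. Then b·(b − 2)·(b + 2)·(3b + 2)·(51b + 2)·(13b − 24) ≠ 0. In particular b + 2 is invertible, so the parameter a = −2/(b+2) is well defined, and a satisfies none of the degeneracy conditions a + 1 = 0, 2a + 3 = 0, 50a + 51 = 0, 25a + 13 = 0, 2a + 1 = 0. -/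
/-- Homogenized form of the quartic: a solution `b = m / n` makes the norm form vanish. -/
theorem quartic_norm_eq_zero {R : Type*} [CommRing R] {b m n : R}
    (hb : b ^ 4 - b ^ 3 + 1 = 0) (h : n * b = m) :
    m ^ 4 - n * m ^ 3 + n ^ 4 = 0 := by
  subst h
  linear_combination n ^ 4 * hb

/-- Good reduction of the Barth quintic: if `char K ∉ {3,5,11,17,433}` and
`b⁴ − b³ + 1 = 0`, then `b(b−2)(b+2)(3b+2)(51b+2)(13b−24) ≠ 0`; in particular
`b + 2` is invertible, `a = −2/(b+2)` is well defined and satisfies none of the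
degeneracy conditions. -/
theorem barth_quintic_good_reduction (K : Type*) [Field K]
    (h3 : (3 : K) ≠ 0) (h5 : (5 : K) ≠ 0) (h11 : (11 : K) ≠ 0)
    (h17 : (17 : K) ≠ 0) (h433 : (433 : K) ≠ 0)
    (b : K) (hb : b ^ 4 - b ^ 3 + 1 = 0) :
    b * (b - 2) * (b + 2) * (3 * b + 2) * (51 * b + 2) * (13 * b - 24) ≠ 0 ∧
    IsUnit (b + 2) ∧
    (-2 / (b + 2) + 1 ≠ 0 ∧ 2 * (-2 / (b + 2)) + 3 ≠ 0 ∧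
      50 * (-2 / (b + 2)) + 51 ≠ 0 ∧ 25 * (-2 / (b + 2)) + 13 ≠ 0 ∧
      2 * (-2 / (b + 2)) + 1 ≠ 0) := by
  have hb0 : b ≠ 0 := by
    rintro rfl
    simp at hb
  have hsub : b - 2 ≠ 0 := fun h ↦ by
    have := quartic_norm_eq_zero (m := 2) (n := 1) hb (by linear_combination h)
    exact pow_ne_zero 2 h3 (by linear_combination this)
  have hadd : b + 2 ≠ 0 := fun h ↦ by
    have := quartic_norm_eq_zero (m := -2) (n := 1) hb (by linear_combination h)
    exact pow_ne_zero 2 h5 (by linear_combination this)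
  have h3b : 3 * b + 2 ≠ 0 := fun h ↦ by
    have := quartic_norm_eq_zero (m := -2) (n := 3) hb (by linear_combination h)
    exact pow_ne_zero 2 h11 (by linear_combination this)
  have h51b : 51 * b + 2 ≠ 0 := fun h ↦ by
    have := quartic_norm_eq_zero (m := -2) (n := 51) hb (by linear_combination h)
    exact mul_ne_zero (pow_ne_zero 6 h5) h433 (by linear_combination this)
  have h13b : 13 * b - 24 ≠ 0 := fun h ↦ by
    have := quartic_norm_eq_zero (m := 24) (n := 13) hb (by linear_combination h)
    exact mul_ne_zero (pow_ne_zero 4 h5) (pow_ne_zero 2 h17) (by linear_combination this)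
  have hne {x c : K} (hc : c ≠ 0) (hx : x = c / (b + 2)) : x ≠ 0 :=
    hx ▸ div_ne_zero hc hadd
  refine ⟨by simp only [ne_eq, mul_eq_zero, not_or]; tauto, hadd.isUnit,
    hne hb0 ?_, hne h3b ?_, hne h51b ?_, hne h13b ?_, hne hsub ?_⟩ <;>
  · field_simp
    ring
end

section
/- Let R be a commutative ring, λ ∈ R, and x₀, x₁, x₂, x₃, x₄ ∈ R with x₀ + x₁ + x₂ + x₃ + x₄ = 0. Then 6·(λ+1)·(x₀⁵ + ⋯ + x₄⁵) − 30·λ·x₀x₁x₂x₃x₄ = 5·λ·(x₀² + ⋯ + x₄²)·(x₀³ + ⋯ + x₄³) + 6·(x₀⁵ + ⋯ + x₄⁵). (That is, on the hyperplane s₁ = 0 the member S_λ of the pencil coincides, up to the unit (λ+1) when λ+1 is invertible, with the member F_t = s₅ − 5t·x₀x₁x₂x₃x₄ of the Dwork pencil for t = λ/(λ+1).) -/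
/-- On the hyperplane `s₁ = 0`, the member `S_λ` of the pencil coincides, up to the
factor `λ+1`, with the Dwork pencil member `F_t = s₅ − 5t·x₀x₁x₂x₃x₄` for
`t = λ/(λ+1)`:  `6(λ+1)·s₅ − 30λ·x₀x₁x₂x₃x₄ = 5λ·s₂·s₃ + 6·s₅`. -/
theorem pencil_vs_dwork_pencil (R : Type*) [CommRing R] (lam : R)
    (x0 x1 x2 x3 x4 : R) (h : x0 + x1 + x2 + x3 + x4 = 0) :
    6 * (lam + 1) * (x0 ^ 5 + x1 ^ 5 + x2 ^ 5 + x3 ^ 5 + x4 ^ 5) -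
        30 * lam * (x0 * x1 * x2 * x3 * x4) =
      5 * lam * (x0 ^ 2 + x1 ^ 2 + x2 ^ 2 + x3 ^ 2 + x4 ^ 2) *
          (x0 ^ 3 + x1 ^ 3 + x2 ^ 3 + x3 ^ 3 + x4 ^ 3) +
        6 * (x0 ^ 5 + x1 ^ 5 + x2 ^ 5 + x3 ^ 5 + x4 ^ 5) := by
  obtain rfl : x4 = -(x0 + x1 + x2 + x3) := by linear_combination h
  ring
end

section
/- Let K be a field with characteristic different from 2 and from 5, and let x₀, …, x₄ ∈ K satisfy x₀ + ⋯ + x₄ = 0 and x₀² + ⋯ + x₄² = 0. Then x₀⁵ + ⋯ + x₄⁵ = 5·x₀x₁x₂x₃x₄; consequently x₀⁵ + ⋯ + x₄⁵ = 0 if and only if x_i = 0 for some index i. (Hence the curve B₁₀ = {s₁ = s₂ = s₅ = 0} ⊂ ℙ⁴ is contained in the union of the five hyperplanes {x_i = 0}, and decomposes into the five conics C_i : x_i = s₁ = s₂ = 0.) -/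
/-- If `char K ∉ {2,5}` and `s₁ = s₂ = 0`, then `s₅ = 5·x₀x₁x₂x₃x₄`; consequently
`s₅ = 0` iff some coordinate vanishes. Hence `B₁₀ = {s₁ = s₂ = s₅ = 0}` decomposes
into the five conics `C_i : x_i = s₁ = s₂ = 0`. -/
theorem B10_decomposes_into_conics (K : Type*) [Field K]
    (h2 : (2 : K) ≠ 0) (h5 : (5 : K) ≠ 0)
    (x0 x1 x2 x3 x4 : K)
    (hs1 : x0 + x1 + x2 + x3 + x4 = 0)
    (hs2 : x0 ^ 2 + x1 ^ 2 + x2 ^ 2 + x3 ^ 2 + x4 ^ 2 = 0) :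
    x0 ^ 5 + x1 ^ 5 + x2 ^ 5 + x3 ^ 5 + x4 ^ 5 = 5 * (x0 * x1 * x2 * x3 * x4) ∧
    (x0 ^ 5 + x1 ^ 5 + x2 ^ 5 + x3 ^ 5 + x4 ^ 5 = 0 ↔
      (x0 = 0 ∨ x1 = 0 ∨ x2 = 0 ∨ x3 = 0 ∨ x4 = 0)) := by
  have he2 : x0 * x1 + x0 * x2 + x0 * x3 + x0 * x4 + x1 * x2 +
      x1 * x3 + x1 * x4 + x2 * x3 + x2 * x4 + x3 * x4 = 0 :=
    mul_left_cancel₀ h2 (by linear_combination (x0 + x1 + x2 + x3 + x4) * hs1 - hs2)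
  -- Newton's identity `p₅ = e₁p₄ - e₂p₃ + e₃p₂ - e₄p₁ + 5e₅`
  have hs5 : x0 ^ 5 + x1 ^ 5 + x2 ^ 5 + x3 ^ 5 + x4 ^ 5 = 5 * (x0 * x1 * x2 * x3 * x4) := by
    linear_combination (x0 ^ 4 + x1 ^ 4 + x2 ^ 4 + x3 ^ 4 + x4 ^ 4) * hs1 -
      (x0 ^ 3 + x1 ^ 3 + x2 ^ 3 + x3 ^ 3 + x4 ^ 3) * he2 +
      (x0 * x1 * x2 + x0 * x1 * x3 + x0 * x1 * x4 + x0 * x2 * x3 + x0 * x2 * x4 +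
        x0 * x3 * x4 + x1 * x2 * x3 + x1 * x2 * x4 + x1 * x3 * x4 + x2 * x3 * x4) * hs2 -
      (x0 * x1 * x2 * x3 + x0 * x1 * x2 * x4 +
        x0 * x1 * x3 * x4 + x0 * x2 * x3 * x4 + x1 * x2 * x3 * x4) * hs1
  refine ⟨hs5, ?_⟩
  rw [hs5]
  simp [h5, or_assoc]
end

section
/- Let K be a field with characteristic different from 3 and from 5, and let x₀, …, x₄ ∈ K. Then x₀ + ⋯ + x₄ = 0, x₀³ + ⋯ + x₄³ = 0 and x₀⁵ + ⋯ + x₄⁵ = 0 hold simultaneously if and only if there are pairwise distinct indices i₁, i₂, i₃, i₄, i₅ with {i₁,…,i₅} = {0,1,2,3,4} such that x_{i₁} = 0, x_{i₂} + x_{i₃} = 0 and x_{i₄} + x_{i₅} = 0. (Hence the curve B₁₅ = {s₁ = s₃ = s₅ = 0} ⊂ ℙ⁴ consists exactly of the 15 lines x_{i₁} = x_{i₂}+x_{i₃} = x_{i₄}+x_{i₅} = 0.) -/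
/-- Four elements whose first and third power sums vanish split into two opposite pairs,
provided `3 ≠ 0`. -/
theorem opposite_pairs_of_sum_eq_zero_of_sum_cube_eq_zero {K : Type*} [Field K]
    (h3 : (3 : K) ≠ 0) {a b c d : K} (h₁ : a + b + c + d = 0)
    (h₃ : a ^ 3 + b ^ 3 + c ^ 3 + d ^ 3 = 0) :
    (a + b = 0 ∧ c + d = 0) ∨ (a + c = 0 ∧ b + d = 0) ∨ (a + d = 0 ∧ b + c = 0) := by
  obtain rfl : d = -(a + b + c) := by linear_combination h₁
  have h : (a + b) * (a + c) * (b + c) = 0 :=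
    (mul_eq_zero.1 (by linear_combination -h₃ :
      (3 : K) * ((a + b) * (a + c) * (b + c)) = 0)).resolve_left h3
  rcases mul_eq_zero.1 h with h | h
  · rcases mul_eq_zero.1 h with h | h
    · exact Or.inl ⟨h, by linear_combination -h⟩
    · exact Or.inr (Or.inl ⟨h, by linear_combination -h⟩)
  · exact Or.inr (Or.inr ⟨by linear_combination -h, h⟩)

/-- Five elements whose first, third and fifth power sums vanish have product zero,
provided `3 ≠ 0` and `5 ≠ 0`. -/
theorem prod_eq_zero_of_odd_power_sums_eq_zero {K : Type*} [Field K]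
    (h3 : (3 : K) ≠ 0) (h5 : (5 : K) ≠ 0) {a b c d e : K}
    (h₁ : a + b + c + d + e = 0) (h₃ : a ^ 3 + b ^ 3 + c ^ 3 + d ^ 3 + e ^ 3 = 0)
    (h₅ : a ^ 5 + b ^ 5 + c ^ 5 + d ^ 5 + e ^ 5 = 0) : a * b * c * d * e = 0 := by
  obtain rfl : e = -(a + b + c + d) := by linear_combination h₁
  have he₃ : a * b * c + a * b * d + a * c * d + b * c * d
      - (a * b + a * c + a * d + b * c + b * d + c * d) * (a + b + c + d) = 0 :=
    (mul_eq_zero.1 (by linear_combination h₃ : (3 : K) * _ = 0)).resolve_left h3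
  refine (mul_eq_zero.1 (?_ : (5 : K) * _ = 0)).resolve_left h5
  linear_combination h₅ + 5 * (a * b + a * c + a * d + b * c + b * d + c * d
    - (a + b + c + d) ^ 2) * he₃

/-- If `char K ∉ {3,5}`, then `s₁ = s₃ = s₅ = 0` holds iff, after a permutation of
the five coordinates, `x_{i₁} = 0`, `x_{i₂} + x_{i₃} = 0` and `x_{i₄} + x_{i₅} = 0`.
Hence `B₁₅ = {s₁ = s₃ = s₅ = 0}` consists exactly of the 15 lines. -/
theorem B15_is_fifteen_lines (K : Type*) [Field K]
    (h3 : (3 : K) ≠ 0) (h5 : (5 : K) ≠ 0) (x : Fin 5 → K) :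
    ((∑ i, x i) = 0 ∧ (∑ i, x i ^ 3) = 0 ∧ (∑ i, x i ^ 5) = 0) ↔
      ∃ σ : Equiv.Perm (Fin 5),
        x (σ 0) = 0 ∧ x (σ 1) + x (σ 2) = 0 ∧ x (σ 3) + x (σ 4) = 0 := by
  constructor
  · rintro ⟨h₁, h₃, h₅⟩
    have hprod : ∏ i, x i = 0 := by
      rw [Fin.sum_univ_five] at h₁ h₃ h₅
      rw [Fin.prod_univ_five]
      exact prod_eq_zero_of_odd_power_sums_eq_zero h3 h5 h₁ h₃ h₅
    obtain ⟨i, -, hi⟩ := Finset.prod_eq_zero_iff.1 hprod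
    obtain ⟨σ, hσ⟩ : ∃ σ : Equiv.Perm (Fin 5), x (σ 0) = 0 :=
      ⟨Equiv.swap 0 i, by rwa [Equiv.swap_apply_left]⟩
    rw [← Equiv.sum_comp σ, Fin.sum_univ_five, hσ] at h₁ h₃
    rcases opposite_pairs_of_sum_eq_zero_of_sum_cube_eq_zero h3
        (a := x (σ 1)) (b := x (σ 2)) (c := x (σ 3)) (d := x (σ 4))
        (by linear_combination h₁) (by linear_combination h₃) with h | h | h
    · exact ⟨σ, hσ, h⟩
    · exact ⟨(Equiv.swap 2 3).trans σ, hσ, h⟩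
    · exact ⟨(Equiv.swap 2 4).trans σ, hσ, h.1, by rw [add_comm]; exact h.2⟩
  · rintro ⟨σ, h₀, h₁₂, h₃₄⟩
    have h₂ := eq_neg_of_add_eq_zero_right h₁₂
    have h₄ := eq_neg_of_add_eq_zero_right h₃₄
    refine ⟨?_, ?_, ?_⟩ <;> rw [← Equiv.sum_comp σ, Fin.sum_univ_five, h₀, h₂, h₄] <;> ring
end

section
/- Let K be a field with characteristic different from 5. Let x : Fin 5 → K be not identically zero and let c ∈ K satisfy x((i+1) mod 5) = c·x(i) for all i (so that (x₀:…:x₄) ∈ ℙ⁴ is a fixed point of the cyclic coordinate shift R). If x₀ + x₁ + x₂ + x₃ + x₄ = 0, then x₀² + ⋯ + x₄² = 0, x₀³ + ⋯ + x₄³ = 0, and x₀⁵ + ⋯ + x₄⁵ = 5·x₀⁵ ≠ 0. (Hence no fixed point of R lies on any member S_λ of the pencil, so the induced ℤ/5ℤ-action on each S_λ is free.) -/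
/-- If `char K ≠ 5`, a fixed point of the cyclic coordinate shift `R` on ℙ⁴ that
lies on the hyperplane `s₁ = 0` satisfies `s₂ = 0`, `s₃ = 0` and
`s₅ = 5·x₀⁵ ≠ 0`. Hence no fixed point of `R` lies on any member `S_λ` of the
pencil, so the induced `ℤ/5ℤ`-action on each `S_λ` is free. -/
theorem shift_fixed_point_not_on_pencil (K : Type*) [Field K] (h5 : (5 : K) ≠ 0)
    (x : Fin 5 → K) (hx : x ≠ 0) (c : K)
    (hc : ∀ i : Fin 5, x (i + 1) = c * x i)
    (hsum : ∑ i, x i = 0) :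
    (∑ i, x i ^ 2) = 0 ∧ (∑ i, x i ^ 3) = 0 ∧
      (∑ i, x i ^ 5) = 5 * x 0 ^ 5 ∧ (∑ i, x i ^ 5) ≠ 0 := by
  have h1 : x 1 = c * x 0 := hc 0
  have h2 : x 2 = c ^ 2 * x 0 := by rw [show x 2 = c * x 1 from hc 1, h1]; ring
  have h3 : x 3 = c ^ 3 * x 0 := by rw [show x 3 = c * x 2 from hc 2, h2]; ring
  have h4 : x 4 = c ^ 4 * x 0 := by rw [show x 4 = c * x 3 from hc 3, h3]; ring
  have h0 : x 0 ≠ 0 := by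
    intro h
    apply hx
    funext i
    fin_cases i <;> simp [h, h1, h2, h3, h4]
  simp only [Fin.sum_univ_five, h1, h2, h3, h4] at hsum ⊢
  have hΦ : 1 + c + c ^ 2 + c ^ 3 + c ^ 4 = 0 :=
    mul_right_cancel₀ h0 (by linear_combination hsum)
  have hs₅ : x 0 ^ 5 + (c * x 0) ^ 5 + (c ^ 2 * x 0) ^ 5 + (c ^ 3 * x 0) ^ 5 +
      (c ^ 4 * x 0) ^ 5 = 5 * x 0 ^ 5 := by
    have hc₅ : c ^ 5 = 1 := by linear_combination (c - 1) * hΦ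
    simp only [mul_pow, ← pow_mul, mul_comm _ 5]
    simp only [pow_mul, hc₅]
    ring
  refine ⟨?_, ?_, hs₅, hs₅ ▸ mul_ne_zero h5 (pow_ne_zero 5 h0)⟩
  · linear_combination x 0 ^ 2 * (1 - c + c ^ 2 - c ^ 3 + c ^ 4) * hΦ
  · linear_combination x 0 ^ 3 * (1 - c + c ^ 3 - c ^ 4 + c ^ 5 - c ^ 7 + c ^ 8) * hΦ
end

section
/- Let R be a commutative ring and let b ∈ R satisfy b⁴ − b³ + 1 = 0. For all s, t ∈ R, let (x₀, x₁, x₂, x₃, x₄) := (s + t(b−1), −s + t, s·b − t(b−1), −s·b, −t), i.e. the point s·P + t·Q on the line through P = (1, −1, b, −b, 0) and Q = (b−1, 1, −(b−1), 0, −1). Then x₀ + x₁ + x₂ + x₃ + x₄ = 0 and −10·(x₀² + ⋯ + x₄²)·(x₀³ + ⋯ + x₄³) + 6·(b+2)·(x₀⁵ + ⋯ + x₄⁵) = 0. (Hence the line span{P, Q} lies on the quintic S_a with parameter a = −2/(b+2) whenever b+2 is invertible.) -/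
/-- The line through `P = (1,−1,b,−b,0)` and `Q = (b−1,1,−(b−1),0,−1)` lies on the
Barth quintic `S_a` (`a = −2/(b+2)`, `b⁴ − b³ + 1 = 0`): every point `s·P + t·Q`
satisfies `s₁ = 0` and `−10·s₂·s₃ + 6(b+2)·s₅ = 0`. -/
theorem line_on_barth_quintic (R : Type*) [CommRing R]
    (b : R) (hb : b ^ 4 - b ^ 3 + 1 = 0) (s t : R)
    (x0 x1 x2 x3 x4 : R)
    (hx0 : x0 = s + t * (b - 1)) (hx1 : x1 = -s + t)
    (hx2 : x2 = s * b - t * (b - 1)) (hx3 : x3 = -(s * b)) (hx4 : x4 = -t) :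
    x0 + x1 + x2 + x3 + x4 = 0 ∧
    -10 * (x0 ^ 2 + x1 ^ 2 + x2 ^ 2 + x3 ^ 2 + x4 ^ 2) *
        (x0 ^ 3 + x1 ^ 3 + x2 ^ 3 + x3 ^ 3 + x4 ^ 3) +
      6 * (b + 2) * (x0 ^ 5 + x1 ^ 5 + x2 ^ 5 + x3 ^ 5 + x4 ^ 5) = 0 := by
  subst hx0 hx1 hx2 hx3 hx4
  constructor
  · ring
  · linear_combination
      (30 * b * s * t * (t - s) * (b * (t ^ 2 - s * t + s ^ 2) - 2 * t * (t - s))) * hb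
end

section
/- Let R be a commutative ring in which 2 = 0 and let ω ∈ R satisfy ω² + ω + 1 = 0. For all x₃, x₄ ∈ R set x₀ := ω²·x₃ + ω·x₄, x₁ := x₀ + ω²·x₄, x₂ := x₀ + ω·x₃. Then x₀ + x₁ + x₂ + x₃ + x₄ = 0 and x₀⁵ + x₁⁵ + x₂⁵ + x₃⁵ + x₄⁵ = 0. (Hence the line ℓ₂ : x₀ + x₁ − ω²x₄ = x₀ + x₂ − ωx₃ = 0 lies on the quintic S₀ : {s₁ = s₅ = 0} in characteristic 2.) -/
/-- In characteristic 2, with `ω` a primitive third root of unity, the line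
`ℓ₂ : x₀ + x₁ − ω²x₄ = x₀ + x₂ − ωx₃ = 0` lies on the quintic
`S₀ : {s₁ = s₅ = 0}`. -/
theorem extra_line_on_S0_char_two (R : Type*) [CommRing R]
    (h2 : (2 : R) = 0) (ω : R) (hω : ω ^ 2 + ω + 1 = 0)
    (x3 x4 : R) (x0 x1 x2 : R)
    (hx0 : x0 = ω ^ 2 * x3 + ω * x4)
    (hx1 : x1 = x0 + ω ^ 2 * x4)
    (hx2 : x2 = x0 + ω * x3) :
    x0 + x1 + x2 + x3 + x4 = 0 ∧
      x0 ^ 5 + x1 ^ 5 + x2 ^ 5 + x3 ^ 5 + x4 ^ 5 = 0 := by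
  have pow_five (u v : R) : (u + v) ^ 5 = u ^ 5 + u ^ 4 * v + u * v ^ 4 + v ^ 5 := by
    linear_combination (2 * u ^ 4 * v + 5 * u ^ 3 * v ^ 2 + 5 * u ^ 2 * v ^ 3 + 2 * u * v ^ 4) * h2
  have hω3 : ω ^ 3 = 1 := by linear_combination (ω - 1) * hω
  have e1 : x1 = ω ^ 2 * x3 + -x4 := by rw [hx1, hx0]; linear_combination x4 * hω
  have e2 : x2 = -x3 + ω * x4 := by rw [hx2, hx0]; linear_combination x3 * hω
  constructor
  · rw [e1, e2, hx0]
    linear_combination (ω ^ 2 * x3 + ω * x4) * h2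
  · rw [e1, e2, hx0, pow_five, pow_five, pow_five]
    linear_combination (ω ^ 10 * x3 ^ 5 + ω ^ 5 * x4 ^ 5) * h2
      + (x3 ^ 4 * x4 + x3 * x4 ^ 4) * hω
      + (x3 ^ 4 * x4 * (ω ^ 6 + ω ^ 3 + 1 - ω ^ 5 - ω ^ 2) + x3 * x4 ^ 4 * (ω ^ 3 + 1 - ω)) * hω3
      + (-ω ^ 2 * x3 ^ 4 * x4 - ω * x3 * x4 ^ 4) * h2
end

section
/- Let K be an algebraically closed field whose characteristic is not one of 3, 5, 13, 17, and let F := x₀⁵ + x₁⁵ + x₂⁵ + x₃⁵ + (−(x₀+x₁+x₂+x₃))⁵ ∈ K[x₀,x₁,x₂,x₃]. Then the projective quintic surface {F = 0} ⊂ ℙ³ is smooth: there is no x ∈ K⁴, x ≠ 0, with F(x) = 0 and all four partial derivatives ∂F/∂x_i vanishing at x. -/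
open MvPolynomial

/-- The four units of the Gaussian integers, as pairs of real and imaginary part. -/
def gaussianUnits : Finset (ℤ × ℤ) := {(1, 0), (-1, 0), (0, 1), (0, -1)}

theorem exists_gaussianUnits_of_pow_four_eq {K : Type*} [Field K] {I a b : K}
    (hI : I ^ 2 = -1) (h : a ^ 4 = b ^ 4) :
    ∃ p ∈ gaussianUnits, a = ((p.1 : K) + (p.2 : K) * I) * b := by
  have h' : (a - b) * ((a + b) * ((a - I * b) * (a + I * b))) = 0 := by
    linear_combination h - (a ^ 2 - b ^ 2) * b ^ 2 * hI
  rcases mul_eq_zero.1 h' with h | h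
  · exact ⟨(1, 0), by decide, by push_cast; linear_combination h⟩
  rcases mul_eq_zero.1 h with h | h
  · exact ⟨(-1, 0), by decide, by push_cast; linear_combination h⟩
  rcases mul_eq_zero.1 h with h | h
  · exact ⟨(0, 1), by decide, by push_cast; linear_combination h⟩
  · exact ⟨(0, -1), by decide, by push_cast; linear_combination h⟩

set_option maxRecDepth 10000 in
theorem norm_one_add_gaussianUnits_mem :
    ∀ p ∈ gaussianUnits, ∀ q ∈ gaussianUnits, ∀ r ∈ gaussianUnits, ∀ s ∈ gaussianUnits,
      (p.1 + q.1 + r.1 + s.1 + 1) ^ 2 + (p.2 + q.2 + r.2 + s.2) ^ 2 ∈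
        ({1, 5, 9, 13, 17, 25} : Finset ℤ) := by
  decide

theorem eq_zero_of_pow_four_eq_of_sum_eq_zero {K : Type*} [Field K] [IsAlgClosed K]
    (h3 : (3 : K) ≠ 0) (h5 : (5 : K) ≠ 0) (h13 : (13 : K) ≠ 0) (h17 : (17 : K) ≠ 0)
    {a b c d y : K} (ha : a ^ 4 = y ^ 4) (hb : b ^ 4 = y ^ 4) (hc : c ^ 4 = y ^ 4)
    (hd : d ^ 4 = y ^ 4) (hsum : a + b + c + d + y = 0) : y = 0 := by
  obtain ⟨I, hI⟩ := IsAlgClosed.exists_pow_nat_eq (-1 : K) two_pos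
  obtain ⟨p, hp, rfl⟩ := exists_gaussianUnits_of_pow_four_eq hI ha
  obtain ⟨q, hq, rfl⟩ := exists_gaussianUnits_of_pow_four_eq hI hb
  obtain ⟨r, hr, rfl⟩ := exists_gaussianUnits_of_pow_four_eq hI hc
  obtain ⟨s, hs, rfl⟩ := exists_gaussianUnits_of_pow_four_eq hI hd
  have hmem := norm_one_add_gaussianUnits_mem p hp q hq r hr s hs
  set A := p.1 + q.1 + r.1 + s.1 + 1 with hA
  set B := p.2 + q.2 + r.2 + s.2 with hB
  by_contra hy
  have hAB : (A : K) + B * I = 0 := by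
    refine (mul_eq_zero.1 (?_ : ((A : K) + B * I) * y = 0)).resolve_right hy
    rw [hA, hB]
    push_cast
    linear_combination hsum
  have hnorm : ((A ^ 2 + B ^ 2 : ℤ) : K) = 0 := by
    push_cast
    linear_combination ((A : K) - B * I) * hAB + (B : K) ^ 2 * hI
  have h9 : (9 : K) ≠ 0 := by
    rw [show (9 : K) = 3 * 3 by norm_num]
    exact mul_ne_zero h3 h3
  have h25 : (25 : K) ≠ 0 := by
    rw [show (25 : K) = 5 * 5 by norm_num]
    exact mul_ne_zero h5 h5
  simp only [Finset.mem_insert, Finset.mem_singleton] at hmem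
  rcases hmem with h | h | h | h | h | h <;> rw [h] at hnorm <;> simp_all

/-- Over an algebraically closed field of characteristic not in `{3,5,13,17}`, the
member `S₀` of the pencil, i.e. the quintic
`{x₀⁵ + x₁⁵ + x₂⁵ + x₃⁵ + (−(x₀+x₁+x₂+x₃))⁵ = 0} ⊂ ℙ³`, is smooth. -/
theorem S0_smooth (K : Type*) [Field K] [IsAlgClosed K]
    (h3 : (3 : K) ≠ 0) (h5 : (5 : K) ≠ 0) (h13 : (13 : K) ≠ 0)
    (h17 : (17 : K) ≠ 0)
    (F : MvPolynomial (Fin 4) K)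
    (hF : F = X 0 ^ 5 + X 1 ^ 5 + X 2 ^ 5 + X 3 ^ 5 +
      (-(X 0 + X 1 + X 2 + X 3)) ^ 5) :
    ¬ ∃ x : Fin 4 → K, x ≠ 0 ∧ eval x F = 0 ∧
      ∀ i : Fin 4, eval x (pderiv i F) = 0 := by
  rintro ⟨x, hx, -, hd⟩
  have hpow (i : Fin 4) : x i ^ 4 = (-(x 0 + x 1 + x 2 + x 3)) ^ 4 := by
    have h := hd i
    refine sub_eq_zero.1 ((mul_eq_zero.1 (?_ : (5 : K) * _ = 0)).resolve_left h5)
    rw [hF] at h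
    fin_cases i <;> simp [pderiv_X, Derivation.leibniz_pow, -mul_eq_zero] at h ⊢ <;>
      linear_combination h
  have hy := eq_zero_of_pow_four_eq_of_sum_eq_zero h3 h5 h13 h17
    (hpow 0) (hpow 1) (hpow 2) (hpow 3) (by ring)
  refine hx (funext fun i => ?_)
  have h := hpow i
  rw [hy] at h
  simpa using h
end

section
/- Let R be a commutative ring and let λ, x₀, x₁, x₂, x₃ ∈ R with x₀ + x₁ = 1. Set u := x₀·x₁, x₄ := −(1 + x₂ + x₃), and s_k := x₀^k + x₁^k + x₂^k + x₃^k + x₄^k for k ∈ ℕ. Then 5·λ·s₂·s₃ + 6·s₅ = 30·[ (λ+1)·u² + (λ·(x₂x₃ + x₂²x₃ + x₂x₃² − 1) − 1)·u − (λ+1)·(x₂+1)·(x₃+1)·(x₂+x₃)·(x₂² + x₂x₃ + x₃² + x₂ + x₃ + 1) ]. -/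
/-- Equation of the double sextic birational to the quotient `S_λ/ι`: with
`x₀ + x₁ = 1`, `u = x₀x₁` and `x₄ = −(1 + x₂ + x₃)`, the quintic polynomial
`5λ·s₂·s₃ + 6·s₅` equals `30` times the double sextic equation. -/
theorem quotient_double_sextic_equation (R : Type*) [CommRing R]
    (lam x0 x1 x2 x3 : R) (hsum : x0 + x1 = 1)
    (u x4 : R) (hu : u = x0 * x1) (hx4 : x4 = -(1 + x2 + x3)) :
    5 * lam * (x0 ^ 2 + x1 ^ 2 + x2 ^ 2 + x3 ^ 2 + x4 ^ 2) *
        (x0 ^ 3 + x1 ^ 3 + x2 ^ 3 + x3 ^ 3 + x4 ^ 3) +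
      6 * (x0 ^ 5 + x1 ^ 5 + x2 ^ 5 + x3 ^ 5 + x4 ^ 5) =
    30 * ((lam + 1) * u ^ 2 +
      (lam * (x2 * x3 + x2 ^ 2 * x3 + x2 * x3 ^ 2 - 1) - 1) * u -
      (lam + 1) * (x2 + 1) * (x3 + 1) * (x2 + x3) *
        (x2 ^ 2 + x2 * x3 + x3 ^ 2 + x2 + x3 + 1)) := by
  obtain rfl : x1 = 1 - x0 := eq_sub_of_add_eq' hsum
  subst hu hx4
  ring
end
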